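/- arXiv:1302.6058 — 2 statements merged into one kernel-verified Lean document; each statement's English description precedes it below -/
import Mathlib

section
/- Assume c₀, c₁, c_e > 0. Then the function G is strictly decreasing on (0,∞): for all 0 < U₁ < U₂ one has G(U₂) < G(U₁). -/
open MeasureTheory Real Filter Set

/-- κ = σ²/σx² -/
noncomputable def kap (σ σx : ℝ) : ℝ := σ ^ 2 / σx ^ 2

/-- The marginalized likelihood ratio L(U,V). -/
noncomputable def Lf (σ σx μx U V : ℝ) : ℝ :=
  σ / σx / Real.sqrt (U + kap σ σx) *
    Real.exp ((V + μx * kap σ σx) ^ 2 / (2 * σ ^ 2 * (U + kap σ σx)) - μx ^ 2 / (2 * σx ^ 2))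

/-- The optimum estimate m(U,V). -/
noncomputable def mf (σ σx μx U V : ℝ) : ℝ :=
  (V + μx * kap σ σx) / (U + kap σ σx)

/-- ℓ(U,V) = L(U,V)(c₁ + c_e m(U,V)²). -/
noncomputable def ellf (σ σx μx c₁ ce U V : ℝ) : ℝ :=
  Lf σ σx μx U V * (c₁ + ce * (mf σ σx μx U V) ^ 2)

/-- G(U) = ∫ min{0, c₀ − ℓ(U,V)} N(0, σ²U)(dV). -/
noncomputable def Gf (σ σx μx c₀ c₁ ce U : ℝ) : ℝ :=
  ∫ V : ℝ, min 0 (c₀ - ellf σ σx μx c₁ ce U V) *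
    ((Real.sqrt (2 * Real.pi * σ ^ 2 * U))⁻¹ * Real.exp (-V ^ 2 / (2 * σ ^ 2 * U)))

open ProbabilityTheory

lemma kap_pos {σ σx : ℝ} (hσ : 0 < σ) (hσx : 0 < σx) : 0 < kap σ σx := by
  unfold kap; positivity

lemma Lf_pos {σ σx μx U : ℝ} (hσ : 0 < σ) (hσx : 0 < σx) (hU : 0 ≤ U) (V : ℝ) :
    0 < Lf σ σx μx U V := by
  have := kap_pos hσ hσx
  unfold Lf; positivity

lemma ellf_nonneg {σ σx μx c₁ ce U : ℝ} (hσ : 0 < σ) (hσx : 0 < σx) (hc₁ : 0 < c₁)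
    (hce : 0 < ce) (hU : 0 ≤ U) (V : ℝ) : 0 ≤ ellf σ σx μx c₁ ce U V := by
  have := Lf_pos (μx := μx) hσ hσx hU V
  unfold ellf; positivity

lemma continuous_ellf (σ σx μx c₁ ce U : ℝ) : Continuous (ellf σ σx μx c₁ ce U) := by
  unfold ellf Lf mf; fun_prop

/-- The variance of the increment `W ~ N(0, σ²d)` after tilting its law by `L(U + d, V + ·)`. -/
noncomputable def tiltVar (σ σx U d : ℝ) : ℝ :=
  σ ^ 2 * d * (U + d + kap σ σx) / (U + kap σ σx)

lemma tiltVar_pos {σ σx U d : ℝ} (hσ : 0 < σ) (hσx : 0 < σx) (hU : 0 ≤ U) (hd : 0 < d) :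
    0 < tiltVar σ σx U d := by
  have := kap_pos hσ hσx
  unfold tiltVar; positivity

/-- Tilting a centred Gaussian density by `L` gives a multiple of a shifted Gaussian density. -/
lemma gaussianPDFReal_mul_Lf {σ σx U d : ℝ} (μx : ℝ) (hσ : 0 < σ) (hσx : 0 < σx) (hU : 0 ≤ U)
    (hd : 0 < d) (v w : ℝ) :
    gaussianPDFReal 0 (σ ^ 2 * d).toNNReal w * Lf σ σx μx (U + d) (v + w) =
      Lf σ σx μx U v *
        gaussianPDFReal (mf σ σx μx U v * d) (tiltVar σ σx U d).toNNReal w := by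
  have hκ := kap_pos hσ hσx
  have ht := tiltVar_pos hσ hσx hU hd
  rw [gaussianPDFReal, gaussianPDFReal, Real.coe_toNNReal _ ht.le,
    Real.coe_toNNReal _ (by positivity)]
  unfold Lf mf tiltVar
  generalize kap σ σx = κ at *
  have hsqrt : √(2 * π * (σ ^ 2 * d)) * √(U + d + κ) =
      √(U + κ) * √(2 * π * (σ ^ 2 * d * (U + d + κ) / (U + κ))) := by
    rw [← Real.sqrt_mul (by positivity), ← Real.sqrt_mul (by positivity)]
    congr 1
    field_simp
  have hexp : -(w - 0) ^ 2 / (2 * (σ ^ 2 * d)) +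
      ((v + w + μx * κ) ^ 2 / (2 * σ ^ 2 * (U + d + κ)) - μx ^ 2 / (2 * σx ^ 2)) =
      ((v + μx * κ) ^ 2 / (2 * σ ^ 2 * (U + κ)) - μx ^ 2 / (2 * σx ^ 2)) +
      -(w - (v + μx * κ) / (U + κ) * d) ^ 2 /
        (2 * (σ ^ 2 * d * (U + d + κ) / (U + κ))) := by
    field_simp
    ring
  calc _ = σ / σx * (√(2 * π * (σ ^ 2 * d)) * √(U + d + κ))⁻¹ *
        (rexp (-(w - 0) ^ 2 / (2 * (σ ^ 2 * d))) *
          rexp ((v + w + μx * κ) ^ 2 / (2 * σ ^ 2 * (U + d + κ)) - μx ^ 2 / (2 * σx ^ 2))) := by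
        rw [mul_inv]; ring
    _ = _ := by
        rw [hsqrt, ← Real.exp_add, hexp, Real.exp_add, mul_inv]; ring

lemma integrable_gaussianReal_iff {m : ℝ} {v : NNReal} (hv : v ≠ 0) {f : ℝ → ℝ} :
    Integrable f (gaussianReal m v) ↔ Integrable fun x ↦ gaussianPDFReal m v x * f x := by
  rw [gaussianReal_of_var_ne_zero _ hv, integrable_withDensity_iff_integrable_smul'
    (measurable_gaussianPDF _ _) (ae_of_all _ fun _ ↦ gaussianPDF_lt_top)]
  simp

lemma integrable_Lf_mul_iff {σ σx U d : ℝ} (μx : ℝ) (hσ : 0 < σ) (hσx : 0 < σx) (hU : 0 ≤ U)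
    (hd : 0 < d) (v : ℝ) (q : ℝ → ℝ) :
    Integrable (fun w ↦ Lf σ σx μx (U + d) (v + w) * q w)
        (gaussianReal 0 (σ ^ 2 * d).toNNReal) ↔
      Integrable q (gaussianReal (mf σ σx μx U v * d) (tiltVar σ σx U d).toNNReal) := by
  rw [integrable_gaussianReal_iff (Real.toNNReal_pos.2 (by positivity)).ne',
    integrable_gaussianReal_iff (Real.toNNReal_pos.2 (tiltVar_pos hσ hσx hU hd)).ne']
  simp_rw [← mul_assoc, gaussianPDFReal_mul_Lf μx hσ hσx hU hd, mul_assoc]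
  exact integrable_const_mul_iff (Lf_pos hσ hσx hU v).ne'.isUnit _

lemma integral_Lf_mul {σ σx U d : ℝ} (μx : ℝ) (hσ : 0 < σ) (hσx : 0 < σx) (hU : 0 ≤ U)
    (hd : 0 < d) (v : ℝ) (q : ℝ → ℝ) :
    ∫ w, Lf σ σx μx (U + d) (v + w) * q w ∂(gaussianReal 0 (σ ^ 2 * d).toNNReal) =
      Lf σ σx μx U v *
        ∫ w, q w ∂(gaussianReal (mf σ σx μx U v * d) (tiltVar σ σx U d).toNNReal) := by
  rw [integral_gaussianReal_eq_integral_smul (Real.toNNReal_pos.2 (by positivity)).ne',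
    integral_gaussianReal_eq_integral_smul
      (Real.toNNReal_pos.2 (tiltVar_pos hσ hσx hU hd)).ne', ← integral_const_mul]
  simp_rw [smul_eq_mul, ← mul_assoc, gaussianPDFReal_mul_Lf μx hσ hσx hU hd]

lemma integrable_sq_sub_gaussianReal (m a : ℝ) (v : NNReal) :
    Integrable (fun x ↦ (x - a) ^ 2) (gaussianReal m v) :=
  ((memLp_id_gaussianReal 2).sub (memLp_const a)).integrable_sq

lemma mf_add {σ σx U d : ℝ} (μx : ℝ) (hσ : 0 < σ) (hσx : 0 < σx) (hU : 0 ≤ U) (hd : 0 < d)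
    (v w : ℝ) :
    mf σ σx μx (U + d) (v + w) =
      mf σ σx μx U v + (w - mf σ σx μx U v * d) / (U + d + kap σ σx) := by
  have hκ := kap_pos hσ hσx
  unfold mf
  generalize kap σ σx = κ at *
  field_simp
  ring

lemma integrable_ellf_add {σ σx U d : ℝ} (μx c₁ ce : ℝ) (hσ : 0 < σ) (hσx : 0 < σx) (hU : 0 ≤ U)
    (hd : 0 < d) (v : ℝ) :
    Integrable (fun w ↦ ellf σ σx μx c₁ ce (U + d) (v + w))
      (gaussianReal 0 (σ ^ 2 * d).toNNReal) := by
  unfold ellf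
  rw [integrable_Lf_mul_iff μx hσ hσx hU hd v
    (fun w ↦ c₁ + ce * mf σ σx μx (U + d) (v + w) ^ 2)]
  have h := integrable_sq_sub_gaussianReal (mf σ σx μx U v * d) (-(v + μx * kap σ σx))
    (tiltVar σ σx U d).toNNReal
  refine (integrable_const c₁).add (((h.div_const ((U + d + kap σ σx) ^ 2)).const_mul ce).congr
    (ae_of_all _ fun w ↦ ?_))
  simp only [mf, div_pow, sub_neg_eq_add]
  ring

/-- Strict submartingale inequality for `ℓ`. -/
lemma ellf_lt_integral {σ σx c₁ ce U d : ℝ} (μx : ℝ) (hσ : 0 < σ) (hσx : 0 < σx)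
    (hce : 0 < ce) (hU : 0 ≤ U) (hd : 0 < d) (v : ℝ) :
    ellf σ σx μx c₁ ce U v <
      ∫ w, ellf σ σx μx c₁ ce (U + d) (v + w) ∂(gaussianReal 0 (σ ^ 2 * d).toNNReal) := by
  have hκ := kap_pos hσ hσx
  have ht := tiltVar_pos hσ hσx hU hd
  unfold ellf
  rw [integral_Lf_mul μx hσ hσx hU hd v (fun w ↦ c₁ + ce * mf σ σx μx (U + d) (v + w) ^ 2)]
  refine mul_lt_mul_of_pos_left ?_ (Lf_pos hσ hσx hU v)
  simp_rw [mf_add μx hσ hσx hU hd]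
  set M := mf σ σx μx U v
  set S := U + d + kap σ σx
  have hS : 0 < S := by positivity
  clear_value S
  set s := (tiltVar σ σx U d).toNNReal
  have hs : (0 : ℝ) < s := by simpa [s] using ht
  have hvar : ∫ w, (w - M * d) ^ 2 ∂(gaussianReal (M * d) s) = s := by
    have := variance_eq_integral (μ := gaussianReal (M * d) s) (X := fun x ↦ x) (by fun_prop)
    rw [variance_fun_id_gaussianReal, integral_id_gaussianReal] at this
    exact this.symm
  have hid : Integrable (fun w ↦ w) (gaussianReal (M * d) s) :=
    (memLp_id_gaussianReal 1).integrable (by simp)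
  have hmean : ∫ w, (w - M * d) ∂(gaussianReal (M * d) s) = 0 := by
    rw [integral_sub hid (integrable_const _)]
    simp
  have hi : Integrable (fun w ↦ w - M * d) (gaussianReal (M * d) s) :=
    hid.sub (integrable_const _)
  have hi2 := integrable_sq_sub_gaussianReal (M * d) (M * d) s
  have key : ∫ w, (c₁ + ce * (M + (w - M * d) / S) ^ 2) ∂(gaussianReal (M * d) s) =
      c₁ + ce * M ^ 2 + ce / S ^ 2 * s := by
    calc _ = ∫ w, ((c₁ + ce * M ^ 2) + (2 * ce * M / S) * (w - M * d)
          + (ce / S ^ 2) * (w - M * d) ^ 2) ∂(gaussianReal (M * d) s) := by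
          congr with w; ring
      _ = _ := by
          rw [integral_add (by fun_prop) (by fun_prop),
            integral_add (by fun_prop) (by fun_prop), integral_const_mul,
            integral_const_mul, hmean, hvar]
          simp
  rw [key]
  have : 0 < ce / S ^ 2 * s := by positivity
  linarith

lemma Gf_eq_integral_gaussianReal {σ U : ℝ} (σx μx c₀ c₁ ce : ℝ) (hσ : 0 < σ) (hU : 0 < U) :
    Gf σ σx μx c₀ c₁ ce U =
      ∫ V, min 0 (c₀ - ellf σ σx μx c₁ ce U V) ∂(gaussianReal 0 (σ ^ 2 * U).toNNReal) := by
  have h : 0 < σ ^ 2 * U := by positivity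
  rw [integral_gaussianReal_eq_integral_smul (Real.toNNReal_pos.2 h).ne']
  unfold Gf
  congr with V
  rw [gaussianPDFReal, Real.coe_toNNReal _ h.le, smul_eq_mul, mul_comm, sub_zero]
  simp only [mul_assoc]

lemma exists_lt_ellf {σ σx c₁ ce U : ℝ} (μx c₀ : ℝ) (hσ : 0 < σ) (hσx : 0 < σx) (hc₀ : 0 < c₀)
    (hc₁ : 0 < c₁) (hce : 0 < ce) (hU : 0 ≤ U) : ∃ v, c₀ < ellf σ σx μx c₁ ce U v := by
  have hκ := kap_pos hσ hσx
  set C := σ / σx / √(U + kap σ σx) * rexp (-(μx ^ 2 / (2 * σx ^ 2))) with hC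
  have hCpos : 0 < C := by positivity
  refine ⟨√(c₀ / (C * ce)) * (U + kap σ σx) - μx * kap σ σx, ?_⟩
  have hm : mf σ σx μx U (√(c₀ / (C * ce)) * (U + kap σ σx) - μx * kap σ σx) =
      √(c₀ / (C * ce)) := by
    unfold mf; field_simp; ring
  rw [ellf, hm, Real.sq_sqrt (by positivity)]
  have hL : C ≤ Lf σ σx μx U (√(c₀ / (C * ce)) * (U + kap σ σx) - μx * kap σ σx) := by
    rw [hC, Lf]
    gcongr
    rw [← zero_sub]
    gcongr
    positivity
  calc c₀ < C * (c₁ + ce * (c₀ / (C * ce))) := by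
        rw [show C * (c₁ + ce * (c₀ / (C * ce))) = C * c₁ + c₀ by field_simp]
        linarith [mul_pos hCpos hc₁]
    _ ≤ _ := by gcongr

/-- G is strictly decreasing on (0,∞). -/
theorem G_strictAntiOn (σ σx μx c₀ c₁ ce : ℝ) (hσ : 0 < σ) (hσx : 0 < σx)
    (hc₀ : 0 < c₀) (hc₁ : 0 < c₁) (hce : 0 < ce) :
    StrictAntiOn (Gf σ σx μx c₀ c₁ ce) (Set.Ioi (0 : ℝ)) := by
  intro U hU U' hU' hlt
  rw [Set.mem_Ioi] at hU hU'
  obtain ⟨d, hd, rfl⟩ : ∃ d, 0 < d ∧ U' = U + d := ⟨U' - U, by linarith, by ring⟩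
  rw [Gf_eq_integral_gaussianReal σx μx c₀ c₁ ce hσ hU,
    Gf_eq_integral_gaussianReal σx μx c₀ c₁ ce hσ hU']
  set f : ℝ → ℝ → ℝ := fun U V ↦ min 0 (c₀ - ellf σ σx μx c₁ ce U V) with hf
  have hcont (U : ℝ) : Continuous (f U) :=
    continuous_const.min (continuous_const.sub (continuous_ellf ..))
  have hint {U d : ℝ} (hU : 0 ≤ U) (hd : 0 < d) (v : ℝ) :
      Integrable (fun w ↦ f (U + d) (v + w)) (gaussianReal 0 (σ ^ 2 * d).toNNReal) := by
    refine (integrable_ellf_add μx c₁ ce hσ hσx hU hd v).mono'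
      ((hcont _).comp (by fun_prop)).aestronglyMeasurable (ae_of_all _ fun w ↦ ?_)
    have := ellf_nonneg (μx := μx) hσ hσx hc₁ hce (by positivity : 0 ≤ U + d) (v + w)
    rw [Real.norm_eq_abs, abs_of_nonpos (min_le_left ..), neg_le]
    exact le_min (by linarith) (by linarith)
  have hint0 {U : ℝ} (hU : 0 < U) : Integrable (f U) (gaussianReal 0 (σ ^ 2 * U).toNNReal) := by
    simpa using hint le_rfl hU 0
  set γ := gaussianReal 0 (σ ^ 2 * U).toNNReal with hγ
  set η := gaussianReal 0 (σ ^ 2 * d).toNNReal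
  have hconv : gaussianReal 0 (σ ^ 2 * (U + d)).toNNReal = γ.conv η := by
    rw [gaussianReal_conv_gaussianReal, add_zero, mul_add,
      Real.toNNReal_add (by positivity) (by positivity)]
  have hint_conv : Integrable (f (U + d)) (γ.conv η) := hconv ▸ hint0 hU'
  have hle (v : ℝ) : ∫ w, f (U + d) (v + w) ∂η ≤
      c₀ - ∫ w, ellf σ σx μx c₁ ce (U + d) (v + w) ∂η := by
    have hi := integrable_ellf_add μx c₁ ce hσ hσx hU.le hd v
    calc _ ≤ ∫ w, (c₀ - ellf σ σx μx c₁ ce (U + d) (v + w)) ∂η :=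
          integral_mono (hint hU.le hd v) ((integrable_const _).sub hi) fun w ↦ min_le_right ..
      _ = _ := by rw [integral_sub (integrable_const _) hi]; simp [η]
  have hnonneg (v : ℝ) : 0 ≤ f U v - ∫ w, f (U + d) (v + w) ∂η := by
    have h1 := ellf_lt_integral (c₁ := c₁) μx hσ hσx hce hU.le hd v
    have h2 : ∫ w, f (U + d) (v + w) ∂η ≤ 0 := integral_nonpos fun w ↦ min_le_left ..
    exact sub_nonneg.2 (le_min h2 (by linarith [hle v]))
  have hint_inner : Integrable (fun v ↦ ∫ w, f (U + d) (v + w) ∂η) γ := by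
    have : Integrable (fun p : ℝ × ℝ ↦ f (U + d) (p.1 + p.2)) (γ.prod η) :=
      hint_conv.comp_measurable measurable_add
    exact this.integral_prod_left
  rw [hconv, integral_conv hint_conv, ← sub_pos, ← integral_sub (hint0 hU) hint_inner,
    integral_pos_iff_support_of_nonneg hnonneg ((hint0 hU).sub hint_inner)]
  have hopen : IsOpen {v | c₀ < ellf σ σx μx c₁ ce U v} :=
    isOpen_lt continuous_const (continuous_ellf ..)
  have hpos : 0 < γ {v | c₀ < ellf σ σx μx c₁ ce U v} := by
    refine pos_iff_ne_zero.2 fun h0 ↦ (hopen.measure_pos volume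
      (exists_lt_ellf μx c₀ hσ hσx hc₀ hc₁ hce hU.le)).ne' ?_
    exact gaussianReal_absolutelyContinuous' 0 (Real.toNNReal_pos.2 (by positivity)).ne' h0
  refine hpos.trans_le (measure_mono fun v hv ↦ ?_)
  have h1 := ellf_lt_integral (c₁ := c₁) μx hσ hσx hce hU.le hd v
  have h2 : f U v = c₀ - ellf σ σx μx c₁ ce U v :=
    min_eq_right (by linarith [Set.mem_ofPred_eq ▸ hv])
  exact ne_of_gt (by linarith [hle v])
end

section
/- Let U > 0 and assume that c₀ ≤ ℓ(U,V) for every V ∈ ℝ (equivalently, the integrand of G is everywhere nonpositive). Then G(U) = c₀ − c₁ − c_e·(μ_x² + σ_x²·U/(U+κ)). -/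
open MeasureTheory Real Filter Set

open ProbabilityTheory

/-- The likelihood ratio times the density of `V` under the null hypothesis is the density of `V`
under the alternative. -/
lemma Lf_mul_gaussianPDFReal {σ σx μx U : ℝ} (hσ : 0 < σ) (hσx : 0 < σx) (hU : 0 < U) (V : ℝ) :
    Lf σ σx μx U V * gaussianPDFReal 0 (σ ^ 2 * U).toNNReal V =
      gaussianPDFReal (μx * U) (σx ^ 2 * U * (U + kap σ σx)).toNNReal V := by
  have hk : 0 < kap σ σx := by unfold kap; positivity
  have hσk : σ ^ 2 = kap σ σx * σx ^ 2 := by unfold kap; field_simp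
  unfold Lf gaussianPDFReal
  generalize kap σ σx = k at *
  have hUk : 0 < U + k := by positivity
  rw [Real.coe_toNNReal _ (by positivity), Real.coe_toNNReal _ (by positivity),
    mul_mul_mul_comm, ← Real.exp_add]
  congr 1
  · have h₀ : √(2 * π * (σ ^ 2 * U)) = √(2 * π * U) * σ := by
      rw [show 2 * π * (σ ^ 2 * U) = 2 * π * U * σ ^ 2 by ring, Real.sqrt_mul (by positivity),
        Real.sqrt_sq hσ.le]
    have h₁ : √(2 * π * (σx ^ 2 * U * (U + k))) = √(2 * π * U) * σx * √(U + k) := by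
      rw [show 2 * π * (σx ^ 2 * U * (U + k)) = 2 * π * U * σx ^ 2 * (U + k) by ring,
        Real.sqrt_mul (by positivity), Real.sqrt_mul (by positivity), Real.sqrt_sq hσx.le]
    rw [h₀, h₁]
    field_simp
  · congr 1
    rw [hσk]
    field_simp
    ring

lemma integral_sq_gaussianReal (μ : ℝ) (v : NNReal) :
    ∫ x, x ^ 2 ∂gaussianReal μ v = v + μ ^ 2 := by
  have h := variance_eq_sub (memLp_id_gaussianReal (μ := μ) (v := v) 2)
  simp only [variance_id_gaussianReal, id_eq, integral_id_gaussianReal, Pi.pow_apply] at h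
  linarith

/-- if c₀ ≤ ℓ(U,V) for every V, then
G(U) = c₀ − c₁ − c_e(μx² + σx² U/(U+κ)). -/
theorem G_when_always_decide_H1 (σ σx μx c₀ c₁ ce : ℝ) (hσ : 0 < σ) (hσx : 0 < σx)
    (hc₀ : 0 ≤ c₀) (hc₁ : 0 ≤ c₁) (hce : 0 ≤ ce) :
    ∀ U : ℝ, 0 < U →
      (∀ V : ℝ, c₀ ≤ ellf σ σx μx c₁ ce U V) →
      Gf σ σx μx c₀ c₁ ce U =
        c₀ - c₁ - ce * (μx ^ 2 + σx ^ 2 * U / (U + kap σ σx)) := by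
  intro U hU h
  have hk : 0 < kap σ σx := by unfold kap; positivity
  have hUk : 0 < U + kap σ σx := by positivity
  set v₀ := (σ ^ 2 * U).toNNReal with hv₀
  set v₁ := (σx ^ 2 * U * (U + kap σ σx)).toNNReal with hv₁
  have hv₀' : (v₀ : ℝ) = σ ^ 2 * U := Real.coe_toNNReal _ (by positivity)
  have hv₁' : (v₁ : ℝ) = σx ^ 2 * U * (U + kap σ σx) := Real.coe_toNNReal _ (by positivity)
  have hv₀_ne : v₀ ≠ 0 := (Real.toNNReal_pos.2 (by positivity)).ne'
  have hv₁_ne : v₁ ≠ 0 := (Real.toNNReal_pos.2 (by positivity)).ne'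
  have hint : ∀ V, min 0 (c₀ - ellf σ σx μx c₁ ce U V) *
      ((√(2 * π * σ ^ 2 * U))⁻¹ * rexp (-V ^ 2 / (2 * σ ^ 2 * U))) =
      c₀ * gaussianPDFReal 0 v₀ V -
        gaussianPDFReal (μx * U) v₁ V * (c₁ + ce * mf σ σx μx U V ^ 2) := by
    intro V
    rw [min_eq_right (by linarith [h V]), ← Lf_mul_gaussianPDFReal hσ hσx hU V, ← hv₀]
    simp only [ellf, gaussianPDFReal, hv₀', sub_zero, ← mul_assoc]
    ring
  have hid : Integrable (fun x : ℝ ↦ x) (gaussianReal (μx * U) v₁) :=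
    (memLp_id_gaussianReal (μ := μx * U) (v := v₁) 1).integrable (by simp)
  have hsq : Integrable (fun x : ℝ ↦ x ^ 2) (gaussianReal (μx * U) v₁) :=
    (memLp_id_gaussianReal (μ := μx * U) (v := v₁) 2).integrable_sq
  have hlin (a b : ℝ) : Integrable (fun x : ℝ ↦ a + b * x) (gaussianReal (μx * U) v₁) :=
    (integrable_const a).add (hid.const_mul b)
  set e := U + kap σ σx with he
  have hm : ∀ V, c₁ + ce * mf σ σx μx U V ^ 2 =
      (c₁ + ce * (μx * kap σ σx) ^ 2 / e ^ 2) + (2 * ce * (μx * kap σ σx) / e ^ 2) * V +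
        (ce / e ^ 2) * V ^ 2 := by
    intro V
    unfold mf
    rw [← he]
    field_simp
    ring
  have hq : Integrable (fun V ↦ c₁ + ce * mf σ σx μx U V ^ 2) (gaussianReal (μx * U) v₁) := by
    simp only [hm]
    exact (hlin _ _).add (hsq.const_mul _)
  have hq_eq : ∫ V, (c₁ + ce * mf σ σx μx U V ^ 2) ∂gaussianReal (μx * U) v₁ =
      c₁ + ce * (μx ^ 2 + σx ^ 2 * U / e) := by
    simp only [hm]
    rw [integral_add (hlin _ _) (hsq.const_mul _),
      integral_add (integrable_const _) (hid.const_mul _), integral_const_mul, integral_const_mul,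
      integral_sq_gaussianReal, integral_id_gaussianReal, hv₁']
    simp only [integral_const, probReal_univ, one_smul]
    have : kap σ σx = e - U := by rw [he]; ring
    rw [this]
    field_simp
    ring
  have hq' : Integrable
      (fun V ↦ gaussianPDFReal (μx * U) v₁ V * (c₁ + ce * mf σ σx μx U V ^ 2)) := by
    rw [gaussianReal_of_var_ne_zero _ hv₁_ne,
      integrable_withDensity_iff_integrable_smul' (measurable_gaussianPDF _ _)
        (.of_forall fun _ ↦ gaussianPDF_lt_top)] at hq
    simpa only [toReal_gaussianPDF, smul_eq_mul] using hq
  rw [integral_gaussianReal_eq_integral_smul hv₁_ne] at hq_eq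
  simp only [smul_eq_mul] at hq_eq
  unfold Gf
  simp only [hint]
  rw [integral_sub ((integrable_gaussianPDFReal _ _).const_mul _) hq', integral_const_mul,
    integral_gaussianPDFReal_eq_one _ hv₀_ne, hq_eq]
  ring
end
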